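/- arXiv:1609.01090 — 2 statements merged into one kernel-verified Lean document; each statement's English description precedes it below -/
import Mathlib

section
/- Let (X, 𝔄, μ) be a measure space, let 0 < r < p < ∞, let A ∈ [0, ∞), and let f : X → ℂ be measurable with ‖f‖_{L^{p,∞}(μ)} ≤ A. Then for every measurable set E with 0 < μ(E) < ∞ there exists a measurable subset Ẽ ⊆ E with μ(Ẽ) ≥ μ(E)/2 such that (∫_Ẽ |f|^r dμ)^{1/r} ≤ 2^{1/p} · A · μ(E)^{1/r − 1/p}. -/
open MeasureTheory ENNReal

/-- The weak-`L^t` quasinorm `‖f‖_{L^{t,∞}(μ)} = sup_{λ>0} λ · μ({|f| > λ})^{1/t}`. -/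
noncomputable def weakNorm {X : Type*} [MeasurableSpace X] (μ : Measure X) (t : ℝ)
    (f : X → ℂ) : ℝ≥0∞ :=
  ⨆ (l : ℝ) (_ : 0 < l), ENNReal.ofReal l * μ {x | l < ‖f x‖} ^ (1 / t)

/-- Chebyshev-type bound: at level `A * (2 / m) ^ (1 / p)` the superlevel set of a function with
weak-`L^p` quasinorm at most `A` has measure at most `m / 2`. -/
lemma measure_superlevel_le_of_weakNorm_le {X : Type*} [MeasurableSpace X] {μ : Measure X}
    {p A m : ℝ} (hp : 0 < p) (hA : 0 ≤ A) (hm : 0 < m) {f : X → ℂ}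
    (hwf : weakNorm μ p f ≤ ENNReal.ofReal A) :
    μ {x | A * (2 / m) ^ (1 / p) < ‖f x‖} ≤ ENNReal.ofReal (m / 2) := by
  have key : ∀ l : ℝ, 0 < l →
      ENNReal.ofReal l * μ {x | l < ‖f x‖} ^ (1 / p) ≤ ENNReal.ofReal A := fun l hl =>
    (le_iSup₂ (f := fun (l : ℝ) (_ : 0 < l) =>
      ENNReal.ofReal l * μ {x | l < ‖f x‖} ^ (1 / p)) l hl).trans hwf
  rcases hA.eq_or_lt with rfl | hA
  · have hnull : ∀ n : ℕ, μ {x | 1 / ((n : ℝ) + 1) < ‖f x‖} = 0 := by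
      intro n
      have hn : 0 < 1 / ((n : ℝ) + 1) := by positivity
      have h := key _ hn
      rw [ENNReal.ofReal_zero, nonpos_iff_eq_zero, mul_eq_zero] at h
      rcases h with h | h
      · exact absurd h (ENNReal.ofReal_pos.2 hn).ne'
      · exact (ENNReal.rpow_eq_zero_iff_of_pos (by positivity)).1 h
    have hsub : {x | 0 * (2 / m) ^ (1 / p) < ‖f x‖} ⊆
        ⋃ n : ℕ, {x | 1 / ((n : ℝ) + 1) < ‖f x‖} := by
      intro x hx
      rw [Set.mem_ofPred_eq, zero_mul] at hx
      exact Set.mem_iUnion.2 (exists_nat_one_div_lt hx)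
    exact (measure_mono_null hsub (measure_iUnion_null hnull)).le.trans zero_le
  · have hl : 0 < A * (2 / m) ^ (1 / p) := by positivity
    have h := key _ hl
    rw [mul_comm, ← ENNReal.le_div_iff_mul_le
      (Or.inl (ENNReal.ofReal_pos.2 hl).ne') (Or.inl ENNReal.ofReal_ne_top),
      ← ENNReal.ofReal_div_of_pos hl, one_div, ENNReal.rpow_inv_le_iff hp,
      ENNReal.ofReal_rpow_of_nonneg (by positivity) hp.le] at h
    rw [one_div]
    refine h.trans_eq (congrArg _ ?_)
    rw [div_mul_cancel_left₀ hA.ne', Real.inv_rpow (by positivity),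
      Real.rpow_inv_rpow (by positivity) hp.ne', inv_div]

/-- If `‖f‖_{L^{p,∞}(μ)} ≤ A` and `0 < r < p < ∞`, then every set `E` of finite positive
measure has a major subset `Ẽ` with `(∫_Ẽ |f|^r dμ)^{1/r} ≤ 2^{1/p} A μ(E)^{1/r - 1/p}`. -/
theorem exists_major_subset_of_weakNorm_le {X : Type*} [MeasurableSpace X] (μ : Measure X)
    (r p : ℝ) (hr : 0 < r) (hrp : r < p)
    (A : ℝ) (hA : 0 ≤ A) (f : X → ℂ) (hf : Measurable f)
    (hwf : weakNorm μ p f ≤ ENNReal.ofReal A) :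
    ∀ E : Set X, MeasurableSet E → 0 < μ E → μ E < ∞ →
      ∃ Et : Set X, MeasurableSet Et ∧ Et ⊆ E ∧ μ E / 2 ≤ μ Et ∧
        (∫⁻ x in Et, (‖f x‖₊ : ℝ≥0∞) ^ r ∂μ) ^ (1 / r) ≤
          ENNReal.ofReal (2 ^ (1 / p) * A) * μ E ^ (1 / r - 1 / p) := by
  intro E hE hE0 hEt
  have hp : 0 < p := hr.trans hrp
  set m := (μ E).toReal
  have hm : 0 < m := ENNReal.toReal_pos hE0.ne' hEt.ne
  have hμE : μ E = ENNReal.ofReal m := (ENNReal.ofReal_toReal hEt.ne).symm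
  set L := A * (2 / m) ^ (1 / p) with hL_def
  have hL : 0 ≤ L := by positivity
  have hS : MeasurableSet {x | L < ‖f x‖} := measurableSet_lt measurable_const hf.norm
  have hSμ : μ {x | L < ‖f x‖} ≤ μ E / 2 := by
    refine (measure_superlevel_le_of_weakNorm_le hp hA hm hwf).trans_eq ?_
    rw [hμE, ENNReal.ofReal_div_of_pos two_pos, ENNReal.ofReal_ofNat]
  refine ⟨E \ {x | L < ‖f x‖}, hE.diff hS, Set.sdiff_subset, ?_, ?_⟩
  · calc μ E / 2 = μ E - μ E / 2 := (ENNReal.sub_half hEt.ne).symm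
      _ ≤ μ E - μ {x | L < ‖f x‖} := tsub_le_tsub_left hSμ _
      _ ≤ μ (E \ {x | L < ‖f x‖}) := le_measure_sdiff
  · have hint : ∫⁻ x in E \ {x | L < ‖f x‖}, (‖f x‖₊ : ℝ≥0∞) ^ r ∂μ ≤
        ENNReal.ofReal L ^ r * μ E := by
      calc ∫⁻ x in E \ {x | L < ‖f x‖}, (‖f x‖₊ : ℝ≥0∞) ^ r ∂μ
          ≤ ∫⁻ _ in E \ {x | L < ‖f x‖}, ENNReal.ofReal L ^ r ∂μ := by
            refine setLIntegral_mono measurable_const fun x hx => ?_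
            refine ENNReal.rpow_le_rpow ?_ hr.le
            rw [← enorm_eq_nnnorm, ← ofReal_norm]
            exact ENNReal.ofReal_le_ofReal (not_lt.1 hx.2)
        _ = ENNReal.ofReal L ^ r * μ (E \ {x | L < ‖f x‖}) := setLIntegral_const _ _
        _ ≤ ENNReal.ofReal L ^ r * μ E := by gcongr; exact Set.sdiff_subset
    refine (ENNReal.rpow_le_rpow hint (by positivity)).trans_eq ?_
    rw [ENNReal.mul_rpow_of_nonneg _ _ (by positivity), one_div r,
      ENNReal.rpow_rpow_inv hr.ne', hμE, ENNReal.ofReal_rpow_of_pos hm,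
      ENNReal.ofReal_rpow_of_pos hm, ← ENNReal.ofReal_mul hL,
      ← ENNReal.ofReal_mul (by positivity), hL_def, Real.div_rpow two_pos.le hm.le,
      Real.rpow_sub hm]
    congr 1
    ring
end

section
/- Let (X, 𝔄, μ) be a σ-finite measure space, let 0 < r < p < ∞, let A ∈ [0, ∞), and let f : X → ℂ be measurable. Suppose that for every measurable set E with 0 < μ(E) < ∞ there exists a measurable subset Ẽ ⊆ E with μ(Ẽ) ≥ μ(E)/2 such that (∫_Ẽ |f|^r dμ)^{1/r} ≤ A · μ(E)^{1/r − 1/p}. Then ‖f‖_{L^{p,∞}(μ)} ≤ 2^{1/r} · A. -/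
open MeasureTheory ENNReal

/-- Chebyshev's inequality on a set of at least half the measure: if `|f| ≥ l` on `Et`, then
`l μ(E)^{1/r} ≤ 2^{1/r} (∫_Et |f|^r)^{1/r}`. -/
lemma ofReal_mul_measure_rpow_le_of_half_le {X : Type*} [MeasurableSpace X] {μ : Measure X}
    {r l : ℝ} (hr : 0 < r) {f : X → ℂ} {E Et : Set X} (hEt : MeasurableSet Et)
    (hl : ∀ x ∈ Et, l ≤ ‖f x‖) (hhalf : μ E / 2 ≤ μ Et) :
    ENNReal.ofReal l * μ E ^ (1 / r) ≤
      2 ^ (1 / r) * (∫⁻ x in Et, (‖f x‖₊ : ℝ≥0∞) ^ r ∂μ) ^ (1 / r) := by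
  have hcheb : ENNReal.ofReal l ^ r * μ Et ≤ ∫⁻ x in Et, (‖f x‖₊ : ℝ≥0∞) ^ r ∂μ := by
    rw [← setLIntegral_const]
    refine setLIntegral_mono' hEt fun x hx => ENNReal.rpow_le_rpow ?_ hr.le
    rw [← enorm_eq_nnnorm, ← ofReal_norm]
    exact ENNReal.ofReal_le_ofReal (hl x hx)
  have hdouble : μ E ≤ 2 * μ Et := by
    rw [mul_comm]
    exact (ENNReal.div_le_iff (by simp) (by simp)).1 hhalf
  have hr' : 0 ≤ 1 / r := by positivity
  calc ENNReal.ofReal l * μ E ^ (1 / r)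
      = (ENNReal.ofReal l ^ r * μ E) ^ (1 / r) := by
        rw [ENNReal.mul_rpow_of_nonneg _ _ hr', ← ENNReal.rpow_mul,
          mul_one_div_cancel hr.ne', ENNReal.rpow_one]
    _ ≤ (2 * ∫⁻ x in Et, (‖f x‖₊ : ℝ≥0∞) ^ r ∂μ) ^ (1 / r) := by
        refine ENNReal.rpow_le_rpow ?_ hr'
        calc ENNReal.ofReal l ^ r * μ E ≤ ENNReal.ofReal l ^ r * (2 * μ Et) := by gcongr
          _ = 2 * (ENNReal.ofReal l ^ r * μ Et) := by ring
          _ ≤ _ := mul_le_mul_right hcheb 2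
    _ = _ := ENNReal.mul_rpow_of_nonneg _ _ hr'

/-- If `0 < r < p < ∞` and every set `E` of finite positive measure has a major subset `Ẽ`
with `(∫_Ẽ |f|^r dμ)^{1/r} ≤ A μ(E)^{1/r - 1/p}`, then `‖f‖_{L^{p,∞}(μ)} ≤ 2^{1/r} A`. -/
theorem weakNorm_le_of_major_subsets {X : Type*} [MeasurableSpace X] (μ : Measure X)
    [SigmaFinite μ] (r p : ℝ) (hr : 0 < r) (hrp : r < p)
    (A : ℝ) (hA : 0 ≤ A) (f : X → ℂ) (hf : Measurable f)
    (hmaj : ∀ E : Set X, MeasurableSet E → 0 < μ E → μ E < ∞ →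
      ∃ Et : Set X, MeasurableSet Et ∧ Et ⊆ E ∧ μ E / 2 ≤ μ Et ∧
        (∫⁻ x in Et, (‖f x‖₊ : ℝ≥0∞) ^ r ∂μ) ^ (1 / r) ≤
          ENNReal.ofReal A * μ E ^ (1 / r - 1 / p)) :
    weakNorm μ p f ≤ ENNReal.ofReal (2 ^ (1 / r) * A) := by
  have hp : 0 < p := hr.trans hrp
  have hfin : ∀ l : ℝ, ∀ E : Set X, MeasurableSet E → 0 < μ E → μ E < ∞ →
      (∀ x ∈ E, l ≤ ‖f x‖) →
      ENNReal.ofReal l * μ E ^ (1 / p) ≤ ENNReal.ofReal (2 ^ (1 / r) * A) := by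
    intro l E hE hE0 hEtop hlE
    obtain ⟨Et, hEt, hsub, hhalf, hint⟩ := hmaj E hE hE0 hEtop
    have hcancel0 : μ E ^ (1 / r - 1 / p) ≠ 0 := (ENNReal.rpow_pos hE0 hEtop.ne).ne'
    have hcancel : μ E ^ (1 / r - 1 / p) ≠ ∞ :=
      ENNReal.rpow_ne_top_of_ne_zero hE0.ne' hEtop.ne
    rw [← ENNReal.mul_le_mul_iff_left hcancel0 hcancel, mul_assoc,
      ← ENNReal.rpow_add _ _ hE0.ne' hEtop.ne, add_sub_cancel,
      ENNReal.ofReal_mul (by positivity), ← ENNReal.ofReal_rpow_of_pos two_pos,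
      ENNReal.ofReal_ofNat, mul_assoc]
    exact (ofReal_mul_measure_rpow_le_of_half_le hr hEt (fun x hx => hlE x (hsub hx)) hhalf).trans
      (by gcongr)
  refine iSup₂_le fun l hl => ?_
  have hl0 : ENNReal.ofReal l ≠ 0 := (ENNReal.ofReal_pos.2 hl).ne'
  have hdiv : ∀ m : ℝ≥0∞, ENNReal.ofReal l * m ^ (1 / p) ≤ ENNReal.ofReal (2 ^ (1 / r) * A) ↔
      m ≤ (ENNReal.ofReal (2 ^ (1 / r) * A) / ENNReal.ofReal l) ^ p := by
    intro m
    rw [mul_comm, ← ENNReal.le_div_iff_mul_le (.inl hl0) (.inl ENNReal.ofReal_ne_top), one_div,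
      ENNReal.rpow_inv_le_iff hp]
  rw [hdiv]
  by_contra! hlt
  obtain ⟨E, hE, hsub, hltE, hEtop⟩ :=
    Measure.exists_subset_measure_lt_top (measurableSet_lt measurable_const hf.norm) hlt
  exact hltE.not_ge
    ((hdiv _).1 (hfin l E hE (bot_le.trans_lt hltE) hEtop fun x hx => (hsub hx).le))
end
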